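/- Assume the generalized Hardy–Littlewood conjecture (GHL). Then |Ā_{≤x}| is asymptotically equal to (𝔖_A/2)·x/(log x)³, i.e. |Ā_{≤x}|·(log x)³/x → 𝔖_A/2 as x → ∞. -/

import Mathlib

/-- `Abar` is the set of primes `p` with `p ≡ 2 (mod 3)` such that there exist
`α, β, γ, μ, ν ≥ 1` and primes `q, r`, both coprime to `6`, with
`p + 1 = 2^α * 3^β * q^μ` and `p - 1 = 2^γ * r^ν`. -/
def Abar : Set ℕ :=
  {p | p.Prime ∧ p % 3 = 2 ∧ ∃ α β γ μ ν q r : ℕ,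
    1 ≤ α ∧ 1 ≤ β ∧ 1 ≤ γ ∧ 1 ≤ μ ∧ 1 ≤ ν ∧
    q.Prime ∧ r.Prime ∧ Nat.Coprime q 6 ∧ Nat.Coprime r 6 ∧
    p + 1 = 2 ^ α * 3 ^ β * q ^ μ ∧ p - 1 = 2 ^ γ * r ^ ν}

/-- The singular series constant `𝔖_A = 9 * ∏_{p ≥ 5 prime} (1 - 3/p) (1 - 1/p)⁻³`. -/
noncomputable def SA : ℝ :=
  9 * ∏' p : {p : ℕ // p.Prime ∧ 5 ≤ p},
    (1 - 3 / (p.1 : ℝ)) * ((1 - 1 / (p.1 : ℝ))⁻¹) ^ 3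

/-- `ρ(ℓ)`: the number of residues `n` modulo `ℓ` with `∏ i, (a i * n + b i) ≡ 0 (mod ℓ)`. -/
noncomputable def rho (R : ℕ) (a b : Fin R → ℤ) (ℓ : ℕ) : ℕ :=
  Set.ncard {n : ZMod ℓ | ∏ i, ((a i : ZMod ℓ) * n + (b i : ZMod ℓ)) = 0}

/-- The factor at the prime `ℓ` of the Hardy–Littlewood singular series. -/
noncomputable def singFactor (R : ℕ) (a b : Fin R → ℤ) (ℓ : {ℓ : ℕ // ℓ.Prime}) : ℝ :=
  (1 - (rho R a b ℓ.1 : ℝ) / (ℓ.1 : ℝ)) * ((1 - 1 / (ℓ.1 : ℝ))⁻¹) ^ R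

/-- The Hardy–Littlewood singular series `𝔖` attached to the linear forms `aᵢ n + bᵢ`. -/
noncomputable def singSeries (R : ℕ) (a b : Fin R → ℤ) : ℝ :=
  ∏' ℓ : {ℓ : ℕ // ℓ.Prime}, singFactor R a b ℓ

/-- The number of `n ≤ x` such that `aᵢ n + bᵢ` is prime for all `i`. -/
noncomputable def primeTupleCount (R : ℕ) (a b : Fin R → ℤ) (x : ℝ) : ℕ :=
  Set.ncard {n : ℕ | (n : ℝ) ≤ x ∧
    ∀ i, ∃ pr : ℕ, pr.Prime ∧ a i * (n : ℤ) + b i = (pr : ℤ)}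

/-- The generalized Hardy–Littlewood conjecture with uniform error term. -/
def GHL : Prop :=
  ∀ (R : ℕ) (C ε : ℝ), 0 < C → 0 < ε → ∃ x₀ : ℝ, ∀ x : ℝ, x₀ ≤ x →
    ∀ a b : Fin R → ℤ, (∀ i, 0 < a i) → (∀ i, IsCoprime (a i) (b i)) →
      (∀ i, |(a i : ℝ)| ≤ Real.log x ^ C ∧ |(b i : ℝ)| ≤ Real.log x ^ C) →
      Multipliable (singFactor R a b) →
      |(primeTupleCount R a b x : ℝ) - singSeries R a b * x / (Real.log x) ^ R| ≤
        ε * (singSeries R a b + 1) * x / (Real.log x) ^ R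


/-- Compatibility conditions on the parameters of the system of linear forms
`2uvn + (2ut + 1)`, `un + s`, `vn + t`: consecutive values satisfy `v(un + s) = u(vn + t) + 1`,
and `uv` is divisible by `2` and has no prime factor other than `2` and `3`, the latter
dividing `v`. -/
structure IsAdmissible (u v s t : ℕ) : Prop where
  u_pos : 0 < u
  v_pos : 0 < v
  bezout : v * s = u * t + 1
  two_dvd : 2 ∣ u * v
  three_dvd : 3 ∣ v
  not_dvd : ∀ ℓ : ℕ, ℓ.Prime → 5 ≤ ℓ → ¬ ℓ ∣ u * v
  s_le : s ≤ u

/-- Leading coefficients of the three linear forms. -/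
def leadCoeffs (u v : ℕ) : Fin 3 → ℤ := ![2 * u * v, u, v]

/-- Constant coefficients of the three linear forms. -/
def constCoeffs (u s t : ℕ) : Fin 3 → ℤ := ![2 * u * t + 1, s, t]

lemma rho_eq (u v s t ℓ : ℕ) :
    rho 3 (leadCoeffs u v) (constCoeffs u s t) ℓ =
      Set.ncard {n : ZMod ℓ | (2 * (u : ZMod ℓ) * v * n + (2 * u * t + 1)) *
        ((u : ZMod ℓ) * n + s) * ((v : ZMod ℓ) * n + t) = 0} := by
  simp [rho, leadCoeffs, constCoeffs, Fin.prod_univ_three]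

namespace IsAdmissible

variable {u v s t : ℕ}

lemma rho_two (h : IsAdmissible u v s t) :
    rho 3 (leadCoeffs u v) (constCoeffs u s t) 2 = 1 := by
  have key : ∀ U V S T : ZMod 2, V * S = U * T + 1 → U * V = 0 → ∃ n₀, ∀ n,
      (2 * U * V * n + (2 * U * T + 1)) * (U * n + S) * (V * n + T) = 0 ↔ n = n₀ := by
    decide
  obtain ⟨n₀, hn⟩ := key u v s t (by exact_mod_cast congrArg (Nat.cast : ℕ → ZMod 2) h.bezout)
    (by exact_mod_cast (ZMod.natCast_eq_zero_iff (u * v) 2).2 h.two_dvd)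
  rw [rho_eq]
  simp [hn]

lemma rho_three (h : IsAdmissible u v s t) :
    rho 3 (leadCoeffs u v) (constCoeffs u s t) 3 = 1 := by
  have key : ∀ U V S T : ZMod 3, V * S = U * T + 1 → V = 0 → ∃ n₀, ∀ n,
      (2 * U * V * n + (2 * U * T + 1)) * (U * n + S) * (V * n + T) = 0 ↔ n = n₀ := by
    decide
  obtain ⟨n₀, hn⟩ := key u v s t (by exact_mod_cast congrArg (Nat.cast : ℕ → ZMod 3) h.bezout)
    ((ZMod.natCast_eq_zero_iff v 3).2 h.three_dvd)
  rw [rho_eq]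
  simp [hn]

lemma rho_of_five_le (h : IsAdmissible u v s t) {ℓ : ℕ} (hℓ : ℓ.Prime) (h5 : 5 ≤ ℓ) :
    rho 3 (leadCoeffs u v) (constCoeffs u s t) ℓ = 3 := by
  have : Fact ℓ.Prime := ⟨hℓ⟩
  have hB : (v : ZMod ℓ) * s = u * t + 1 := by
    exact_mod_cast congrArg (Nat.cast : ℕ → ZMod ℓ) h.bezout
  have h2 : (2 : ZMod ℓ) ≠ 0 := by
    intro h0
    have := (ZMod.natCast_eq_zero_iff 2 ℓ).1 (by exact_mod_cast h0)
    exact absurd (Nat.le_of_dvd (by norm_num) this) (by omega)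
  have hU : (u : ZMod ℓ) ≠ 0 := fun h0 =>
    h.not_dvd ℓ hℓ h5 (((ZMod.natCast_eq_zero_iff u ℓ).1 h0).mul_right v)
  have hV : (v : ZMod ℓ) ≠ 0 := fun h0 =>
    h.not_dvd ℓ hℓ h5 (((ZMod.natCast_eq_zero_iff v ℓ).1 h0).mul_left u)
  rw [rho_eq]
  generalize (u : ZMod ℓ) = U at *
  generalize (v : ZMod ℓ) = V at *
  generalize (s : ZMod ℓ) = S at *
  generalize (t : ZMod ℓ) = T at *
  have hset : {n : ZMod ℓ | (2 * U * V * n + (2 * U * T + 1)) * (U * n + S) * (V * n + T) = 0} =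
      {-(2 * U * T + 1) / (2 * U * V), -S / U, -T / V} := by
    ext n
    simp only [Set.mem_ofPred_eq, mul_eq_zero, Set.mem_insert_iff, Set.mem_singleton_iff,
      eq_div_iff hU, eq_div_iff hV, eq_div_iff (mul_ne_zero (mul_ne_zero h2 hU) hV), or_assoc,
      eq_neg_iff_add_eq_zero, mul_comm n]
  rw [hset, Set.ncard_eq_three]
  refine ⟨_, _, _, ?_, ?_, ?_, rfl⟩
  · rw [Ne, div_eq_div_iff (mul_ne_zero (mul_ne_zero h2 hU) hV) hU]
    intro h0
    exact hU (by linear_combination h0 - 2 * U * hB)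
  · rw [Ne, div_eq_div_iff (mul_ne_zero (mul_ne_zero h2 hU) hV) hV]
    intro h0
    exact hV (by linear_combination -h0)
  · rw [Ne, div_eq_div_iff hU hV]
    intro h0
    exact one_ne_zero (by linear_combination -h0 - hB : (1 : ZMod ℓ) = 0)

end IsAdmissible

/-- The local factor of the singular series at a prime `p ≥ 5`. -/
noncomputable def localFactor (p : ℕ) : ℝ :=
  (1 - 3 / (p : ℝ)) * ((1 - 1 / (p : ℝ))⁻¹) ^ 3

lemma abs_localFactor_sub_one_le {p : ℕ} (hp : 5 ≤ p) :
    |localFactor p - 1| ≤ 6 * (1 / (p : ℝ) ^ 2) := by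
  have h5 : (5 : ℝ) ≤ p := by exact_mod_cast hp
  have h0 : (p : ℝ) ≠ 0 := by positivity
  have h1 : (p : ℝ) - 1 ≠ 0 := by linarith
  have hpos : (0 : ℝ) < p - 1 := by linarith
  have heq : localFactor p - 1 = -((3 * p - 1) / ((p : ℝ) - 1) ^ 3) := by
    have : 1 - 1 / (p : ℝ) = (p - 1) / p := by field_simp
    rw [localFactor, this]
    field_simp
    ring
  rw [heq, abs_neg, abs_of_nonneg (div_nonneg (by linarith) (by positivity)),
    mul_one_div, div_le_div_iff₀ (by positivity) (by positivity)]
  nlinarith [mul_nonneg (sub_nonneg.2 h5) (sub_nonneg.2 h5),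
    mul_nonneg (mul_nonneg (sub_nonneg.2 h5) (sub_nonneg.2 h5)) (sub_nonneg.2 h5)]

lemma multipliable_localFactor :
    Multipliable fun p : {p : ℕ // p.Prime ∧ 5 ≤ p} => localFactor p.1 := by
  have hs : Summable fun p : {p : ℕ // p.Prime ∧ 5 ≤ p} => localFactor p.1 - 1 := by
    refine Summable.of_norm_bounded (g := fun p : {p : ℕ // p.Prime ∧ 5 ≤ p} =>
      6 * (1 / (p.1 : ℝ) ^ 2)) ?_ fun p => by
        simpa using abs_localFactor_sub_one_le p.2.2
    exact ((Real.summable_one_div_nat_pow.2 one_lt_two).mul_left 6).comp_injective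
      Subtype.val_injective
  simpa using Real.multipliable_one_add_of_summable hs

lemma IsAdmissible.hasProd_singFactor {u v s t : ℕ} (h : IsAdmissible u v s t) :
    HasProd (singFactor 3 (leadCoeffs u v) (constCoeffs u s t)) SA := by
  set f := singFactor 3 (leadCoeffs u v) (constCoeffs u s t) with hf
  let ℓ₂ : {ℓ : ℕ // ℓ.Prime} := ⟨2, Nat.prime_two⟩
  let ℓ₃ : {ℓ : ℕ // ℓ.Prime} := ⟨3, Nat.prime_three⟩
  have hsmall : HasProd (fun ℓ : {ℓ : ℕ // ℓ.Prime} => if ℓ.1 < 5 then f ℓ else 1) 9 := by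
    have key := hasProd_prod_of_ne_finset_one (L := SummationFilter.unconditional _)
      (f := fun ℓ : {ℓ : ℕ // ℓ.Prime} => if ℓ.1 < 5 then f ℓ else 1) (s := {ℓ₂, ℓ₃}) ?_
    · convert key using 1
      rw [Finset.prod_pair (by simp [ℓ₂, ℓ₃])]
      simp only [ℓ₂, ℓ₃, hf, singFactor, h.rho_two, h.rho_three]
      norm_num
    · rintro ⟨ℓ, hℓ⟩ hmem
      simp only [ℓ₂, ℓ₃, Finset.mem_insert, Finset.mem_singleton, Subtype.mk.injEq] at hmem
      refine if_neg fun hlt => ?_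
      have hlt : ℓ < 5 := hlt
      interval_cases ℓ <;> revert hℓ hmem <;> decide
  have hlarge : HasProd (fun ℓ : {ℓ : ℕ // ℓ.Prime} => if ℓ.1 < 5 then 1 else f ℓ)
      (∏' p : {p : ℕ // p.Prime ∧ 5 ≤ p}, localFactor p.1) := by
    let g : {p : ℕ // p.Prime ∧ 5 ≤ p} → {ℓ : ℕ // ℓ.Prime} := fun p => ⟨p.1, p.2.1⟩
    have hg : Function.Injective g := fun p q hpq => Subtype.ext (Subtype.mk.inj hpq)
    refine (hg.hasProd_iff ?_).1 ?_
    · intro ℓ hℓ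
      refine if_pos ?_
      by_contra hge
      exact hℓ ⟨⟨ℓ.1, ℓ.2, not_lt.1 hge⟩, rfl⟩
    · convert multipliable_localFactor.hasProd using 1
      funext p
      simp [g, not_lt.2 p.2.2, hf, singFactor, h.rho_of_five_le p.2.1 p.2.2, localFactor]
  have hfun : f = fun ℓ => (if ℓ.1 < 5 then f ℓ else 1) * (if ℓ.1 < 5 then 1 else f ℓ) := by
    funext ℓ
    by_cases hlt : ℓ.1 < 5 <;> simp [hlt]
  rw [hfun]
  exact hsmall.mul hlarge

/-- The primes `p` such that `p + 1 = 2vq` and `p - 1 = 2ur` for some primes `q` and `r`. -/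
def constellation (u v : ℕ) : Set ℕ :=
  {p | p.Prime ∧ ∃ q r : ℕ, q.Prime ∧ r.Prime ∧ p + 1 = 2 * v * q ∧ p = 2 * u * r + 1}

lemma IsAdmissible.ncard_constellation {u v s t : ℕ} (h : IsAdmissible u v s t) (x : ℝ) :
    (constellation u v ∩ {n : ℕ | (n : ℝ) ≤ x}).ncard =
      primeTupleCount 3 (leadCoeffs u v) (constCoeffs u s t)
        ((x - (2 * u * t + 1)) / (2 * u * v)) := by
  have hu := h.u_pos
  have hv := h.v_pos
  have hinj : Function.Injective fun n : ℕ => 2 * u * v * n + (2 * u * t + 1) := by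
    intro a b hab
    have : 2 * u * v * a = 2 * u * v * b := Nat.add_right_cancel hab
    exact Nat.eq_of_mul_eq_mul_left (by positivity) this
  refine Eq.trans (congrArg Set.ncard ?_) (Set.ncard_image_of_injective _ hinj)
  have hm : (0 : ℝ) < 2 * u * v := by positivity
  have hle : ∀ n : ℕ, ((2 * u * v * n + (2 * u * t + 1) : ℕ) : ℝ) ≤ x ↔
      (n : ℝ) ≤ (x - (2 * u * t + 1)) / (2 * u * v) := by
    intro n
    rw [le_div_iff₀ hm]
    push_cast
    constructor <;> intro h <;> linarith
  ext p
  simp only [Set.mem_image, Set.mem_inter_iff, Set.mem_ofPred_eq]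
  constructor
  · rintro ⟨⟨hp, q, r, hq, hr, h1, h2⟩, hx⟩
    have hqr : v * q = u * r + 1 := by linarith
    have hdiff : (v : ℤ) * (q - s) = u * (r - t) := by
      have h1 : (v : ℤ) * s = u * t + 1 := by exact_mod_cast h.bezout
      have h2 : (v : ℤ) * q = u * r + 1 := by exact_mod_cast hqr
      linear_combination h2 - h1
    have hcop : IsCoprime (u : ℤ) v :=
      ⟨-t, s, by
        have h1 : (v : ℤ) * s = u * t + 1 := by exact_mod_cast h.bezout
        linear_combination h1⟩
    obtain ⟨n, hn⟩ := hcop.dvd_of_dvd_mul_left ⟨_, hdiff⟩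
    have hn0 : 0 ≤ n := by
      by_contra hneg
      have : (u : ℤ) * n ≤ u * (-1) := by
        apply mul_le_mul_of_nonneg_left <;> omega
      have := h.s_le
      have := hq.pos
      omega
    lift n to ℕ using hn0
    have hqn : q = u * n + s := by zify; linear_combination hn
    have hrn : r = v * n + t := by
      refine Nat.eq_of_mul_eq_mul_left hu ?_
      have := h.bezout
      subst hqn
      nlinarith
    have hpn : 2 * u * v * n + (2 * u * t + 1) = p := by rw [h2, hrn]; ring
    refine ⟨n, ⟨(hle n).1 (by rwa [hpn]), ?_⟩, hpn⟩
    intro i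
    fin_cases i
    · exact ⟨p, hp, by simp [leadCoeffs, constCoeffs, ← hpn]⟩
    · exact ⟨q, hq, by simp [leadCoeffs, constCoeffs, hqn]⟩
    · exact ⟨r, hr, by simp [leadCoeffs, constCoeffs, hrn]⟩
  · rintro ⟨n, ⟨hx, hn⟩, rfl⟩
    obtain ⟨p, hp, hpn⟩ := hn 0
    obtain ⟨q, hq, hqn⟩ := hn 1
    obtain ⟨r, hr, hrn⟩ := hn 2
    simp only [leadCoeffs, constCoeffs, Matrix.cons_val] at hpn hqn hrn
    norm_cast at hpn hqn hrn
    refine ⟨⟨by rwa [hpn], q, r, hq, hr, ?_, ?_⟩, (hle n).2 hx⟩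
    · rw [← hqn]
      linarith [h.bezout, show 2 * v * (u * n + s) = 2 * u * v * n + 2 * (v * s) by ring]
    · rw [← hrn]; ring

lemma IsAdmissible.isCoprime {u v s t : ℕ} (h : IsAdmissible u v s t) (i : Fin 3) :
    IsCoprime (leadCoeffs u v i) (constCoeffs u s t i) := by
  have hB : (v : ℤ) * s = u * t + 1 := by exact_mod_cast h.bezout
  fin_cases i <;> simp only [leadCoeffs, constCoeffs, Fin.zero_eta, Fin.mk_one, Fin.reduceFinMk,
    Matrix.cons_val]
  · refine IsCoprime.mul_left (IsCoprime.mul_left ?_ ?_) ?_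
    · exact ⟨-(u * t), 1, by ring⟩
    · exact ⟨-(2 * t), 1, by ring⟩
    · exact ⟨2 * s, -1, by linear_combination 2 * hB⟩
  · exact ⟨-t, v, by linear_combination hB⟩
  · exact ⟨s, -u, by linear_combination hB⟩

lemma IsAdmissible.const_le {u v s t : ℕ} (h : IsAdmissible u v s t) :
    2 * u * t + 1 ≤ 2 * u * v := by
  have h1 := h.bezout
  have h2 := Nat.mul_le_mul_left v h.s_le
  nlinarith

lemma IsAdmissible.abs_coeffs_le {u v s t : ℕ} (h : IsAdmissible u v s t) {B : ℝ}
    (hB : (2 * u * v : ℝ) ≤ B) (i : Fin 3) :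
    |(leadCoeffs u v i : ℝ)| ≤ B ∧ |(constCoeffs u s t i : ℝ)| ≤ B := by
  have hu := h.u_pos
  have hv := h.v_pos
  have hc := h.const_le
  have hs := h.s_le
  have huv : u ≤ u * v := Nat.le_mul_of_pos_right u hv
  have hvu : v ≤ u * v := Nat.le_mul_of_pos_left v hu
  have ht : t ≤ u * t := Nat.le_mul_of_pos_left t hu
  have key : ∀ n : ℕ, n ≤ 2 * u * v → |((n : ℤ) : ℝ)| ≤ B := by
    intro n hn
    rw [Int.cast_natCast, abs_of_nonneg (Nat.cast_nonneg n)]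
    exact le_trans (by exact_mod_cast hn) hB
  have hbig : ∀ n : ℕ, n ≤ u * v → n ≤ 2 * u * v := fun n hn => by
    rw [mul_assoc]; omega
  fin_cases i
  · exact ⟨by simpa [leadCoeffs] using key (2 * u * v) le_rfl,
      by simpa [constCoeffs] using key (2 * u * t + 1) hc⟩
  · exact ⟨key u (hbig u huv), key s (hbig s (hs.trans huv))⟩
  · exact ⟨key v (hbig v hvu), key t (le_trans (by rw [mul_assoc]; omega) hc)⟩

open Filter Topology

section Uniform

variable {K : Type*}

/-- The filter of pairs `(x, k)` with `x → ∞` and `m k ≤ (log x) ^ 9`. -/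
def polylogFilter (m : K → ℝ) : Filter (ℝ × K) :=
  comap Prod.fst atTop ⊓ 𝓟 {z | m z.2 ≤ Real.log z.1 ^ 9}

lemma tendsto_fst_polylogFilter (m : K → ℝ) : Tendsto Prod.fst (polylogFilter m) atTop :=
  tendsto_comap.mono_left inf_le_left

lemma eventually_le_polylogFilter (m : K → ℝ) :
    ∀ᶠ z in polylogFilter m, m z.2 ≤ Real.log z.1 ^ 9 :=
  mem_inf_of_right (mem_principal_self _)

lemma tendsto_prodMk_polylogFilter (m : K → ℝ) (k : K) :
    Tendsto (fun x : ℝ => (x, k)) atTop (polylogFilter m) := by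
  refine tendsto_inf.2 ⟨tendsto_comap_iff.2 tendsto_id, tendsto_principal.2 ?_⟩
  filter_upwards [((tendsto_pow_atTop (n := 9) (by norm_num)).comp
    Real.tendsto_log_atTop).eventually_ge_atTop (m k)] with x hx
  exact hx

lemma tendsto_log_pow_div_rpow_atTop (n : ℕ) {s : ℝ} (hs : 0 < s) :
    Tendsto (fun x : ℝ => Real.log x ^ n / x ^ s) atTop (𝓝 0) := by
  have h := (isLittleO_log_rpow_rpow_atTop (n : ℝ) hs).tendsto_div_nhds_zero
  simpa using h

lemma tendsto_log_pow_div_atTop (n : ℕ) :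
    Tendsto (fun x : ℝ => Real.log x ^ n / x) atTop (𝓝 0) := by
  simpa using tendsto_log_pow_div_rpow_atTop n one_pos

variable {m c : K → ℝ}

lemma tendsto_mul_rescale_div (hm : ∀ k, 1 ≤ m k) (hc0 : ∀ k, 0 ≤ c k) (hc : ∀ k, c k ≤ m k) :
    Tendsto (fun z : ℝ × K => m z.2 * ((z.1 - c z.2) / m z.2) / z.1) (polylogFilter m)
      (𝓝 1) := by
  have hx := tendsto_fst_polylogFilter m
  have hzero : Tendsto (fun z : ℝ × K => c z.2 / z.1) (polylogFilter m) (𝓝 0) := by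
    refine squeeze_zero' ?_ ?_ ((tendsto_log_pow_div_atTop 9).comp hx)
    · filter_upwards [hx.eventually_gt_atTop 0] with z hz
      exact div_nonneg (hc0 _) hz.le
    · filter_upwards [hx.eventually_gt_atTop 0, eventually_le_polylogFilter m] with z hz hz'
      exact div_le_div_of_nonneg_right ((hc _).trans hz') hz.le
  have h1 := hzero.const_sub 1
  rw [sub_zero] at h1
  refine h1.congr' ?_
  filter_upwards [hx.eventually_gt_atTop 0] with z hz
  have := hm z.2
  field_simp

lemma eventually_sqrt_le_rescale (hm : ∀ k, 1 ≤ m k) (hc : ∀ k, c k ≤ m k) :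
    ∀ᶠ z in polylogFilter m, √z.1 ≤ (z.1 - c z.2) / m z.2 := by
  have hx := tendsto_fst_polylogFilter m
  have h1 : ∀ᶠ x : ℝ in atTop, Real.log x ^ 9 / x ^ (1 / 2 : ℝ) < 1 / 2 :=
    (tendsto_log_pow_div_rpow_atTop 9 (by norm_num)).eventually (gt_mem_nhds (by norm_num))
  filter_upwards [hx.eventually_ge_atTop 1, hx.eventually h1, eventually_le_polylogFilter m]
    with z hz hlog hmz
  have hpos : 0 < m z.2 := zero_lt_one.trans_le (hm _)
  rw [le_div_iff₀ hpos]
  rw [← Real.sqrt_eq_rpow, div_lt_iff₀ (Real.sqrt_pos.2 (by linarith))] at hlog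
  have hs1 : 1 ≤ √z.1 := Real.one_le_sqrt.2 hz
  have hsq : √z.1 * √z.1 = z.1 := Real.mul_self_sqrt (by linarith)
  have := hc z.2
  nlinarith

lemma tendsto_rescale_atTop (hm : ∀ k, 1 ≤ m k) (hc : ∀ k, c k ≤ m k) :
    Tendsto (fun z : ℝ × K => (z.1 - c z.2) / m z.2) (polylogFilter m) atTop :=
  tendsto_atTop_mono' _ (eventually_sqrt_le_rescale hm hc)
    (Real.tendsto_sqrt_atTop.comp (tendsto_fst_polylogFilter m))

lemma eventually_half_log_le_log_rescale (hm : ∀ k, 1 ≤ m k) (hc : ∀ k, c k ≤ m k) :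
    ∀ᶠ z in polylogFilter m, Real.log z.1 / 2 ≤ Real.log ((z.1 - c z.2) / m z.2) := by
  filter_upwards [eventually_sqrt_le_rescale hm hc,
    (tendsto_fst_polylogFilter m).eventually_gt_atTop 0] with z hz hz0
  rw [← Real.log_sqrt hz0.le]
  exact Real.log_le_log (Real.sqrt_pos.2 hz0) hz

lemma tendsto_log_rescale_div_log (hm : ∀ k, 1 ≤ m k) (hc0 : ∀ k, 0 ≤ c k)
    (hc : ∀ k, c k ≤ m k) :
    Tendsto (fun z : ℝ × K => Real.log ((z.1 - c z.2) / m z.2) / Real.log z.1)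
      (polylogFilter m) (𝓝 1) := by
  have hx := tendsto_fst_polylogFilter m
  have hL : Tendsto (fun z : ℝ × K => Real.log z.1) (polylogFilter m) atTop :=
    Real.tendsto_log_atTop.comp hx
  have h1 : Tendsto (fun z : ℝ × K => Real.log (m z.2) / Real.log z.1) (polylogFilter m)
      (𝓝 0) := by
    have hlog : Tendsto (fun z : ℝ × K => 9 * (Real.log (Real.log z.1) ^ 1 / Real.log z.1))
        (polylogFilter m) (𝓝 0) := by
      simpa using ((tendsto_log_pow_div_atTop 1).comp hL).const_mul 9
    refine squeeze_zero' ?_ ?_ hlog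
    · filter_upwards [hL.eventually_gt_atTop 0] with z hz
      exact div_nonneg (Real.log_nonneg (hm _)) hz.le
    · filter_upwards [hL.eventually_gt_atTop 0, eventually_le_polylogFilter m] with z hz hz'
      rw [pow_one, ← mul_div_assoc]
      refine div_le_div_of_nonneg_right ?_ hz.le
      have := Real.log_le_log (zero_lt_one.trans_le (hm _)) hz'
      rwa [Real.log_pow] at this
  have h2 : Tendsto (fun z : ℝ × K => Real.log (m z.2 * ((z.1 - c z.2) / m z.2) / z.1) /
      Real.log z.1) (polylogFilter m) (𝓝 0) :=
    ((tendsto_mul_rescale_div hm hc0 hc).log one_ne_zero).div_atTop hL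
  have h3 := (h2.sub h1).const_add 1
  rw [sub_zero, add_zero] at h3
  refine h3.congr' ?_
  filter_upwards [hL.eventually_gt_atTop 0, hx.eventually_gt_atTop 0,
    (tendsto_rescale_atTop hm hc).eventually_gt_atTop 0] with z hz hz0 hy
  have hmz : 0 < m z.2 := zero_lt_one.trans_le (hm _)
  rw [Real.log_div (mul_pos hmz hy).ne' hz0.ne', Real.log_mul hmz.ne' hy.ne']
  field_simp
  ring

variable {u v s t : K → ℕ}

/-- Under GHL the density of constellations is asymptotically correct, uniformly for moduli of
polylogarithmic size. -/
lemma tendsto_ncard_constellation (hGHL : GHL)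
    (h : ∀ k, IsAdmissible (u k) (v k) (s k) (t k)) :
    Tendsto (fun z : ℝ × K =>
        ((constellation (u z.2) (v z.2) ∩ {n : ℕ | (n : ℝ) ≤ z.1}).ncard : ℝ) *
          (2 * u z.2 * v z.2) * Real.log z.1 ^ 3 / z.1)
      (polylogFilter fun k => (2 * u k * v k : ℝ)) (𝓝 SA) := by
  set m : K → ℝ := fun k => 2 * u k * v k with hm_def
  set c : K → ℝ := fun k => 2 * u k * t k + 1 with hc_def
  have hc0 : ∀ k, 0 ≤ c k := fun k => by positivity
  have hc : ∀ k, c k ≤ m k := fun k => by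
    simp only [hm_def, hc_def]
    exact_mod_cast (h k).const_le
  have hm : ∀ k, 1 ≤ m k := fun k =>
    le_trans (le_add_of_nonneg_left (by positivity)) (hc k)
  set y : ℝ × K → ℝ := fun z => (z.1 - c z.2) / m z.2 with hy_def
  have hx := tendsto_fst_polylogFilter m
  have hL : Tendsto (fun z : ℝ × K => Real.log z.1) (polylogFilter m) atTop :=
    Real.tendsto_log_atTop.comp hx
  have hy : Tendsto y (polylogFilter m) atTop := tendsto_rescale_atTop hm hc
  have hlogy : Tendsto (fun z => Real.log (y z)) (polylogFilter m) atTop :=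
    Real.tendsto_log_atTop.comp hy
  set N : ℝ × K → ℝ := fun z => primeTupleCount 3 (leadCoeffs (u z.2) (v z.2))
    (constCoeffs (u z.2) (s z.2) (t z.2)) (y z) with hN_def
  have hmain : Tendsto (fun z => N z * Real.log (y z) ^ 3 / y z) (polylogFilter m) (𝓝 SA) := by
    rw [Metric.tendsto_nhds]
    intro δ hδ
    set ε : ℝ := δ / (2 * (|SA| + 1)) with hε_def
    have hε : 0 < ε := by positivity
    obtain ⟨x₀, hx₀⟩ := hGHL 3 10 ε (by norm_num) hε
    filter_upwards [hy.eventually_ge_atTop x₀, hy.eventually_gt_atTop 0,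
      hlogy.eventually_gt_atTop 0, hL.eventually_ge_atTop 1024,
      eventually_half_log_le_log_rescale hm hc, eventually_le_polylogFilter m]
      with z hz0 hypos hlogpos hLz hhalf hmz
    have hB : m z.2 ≤ Real.log (y z) ^ (10 : ℝ) := by
      rw [show (10 : ℝ) = ((10 : ℕ) : ℝ) by norm_num, Real.rpow_natCast]
      calc m z.2 ≤ Real.log z.1 ^ 9 := hmz
        _ ≤ (Real.log z.1 / 2) ^ 10 := by
          rw [div_pow, le_div_iff₀ (by norm_num), pow_succ _ 9]
          exact mul_le_mul_of_nonneg_left (by linarith) (by positivity)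
        _ ≤ Real.log (y z) ^ 10 := pow_le_pow_left₀ (by linarith) hhalf 10
    have hprod := (h z.2).hasProd_singFactor
    have key := hx₀ (y z) hz0 (leadCoeffs (u z.2) (v z.2))
      (constCoeffs (u z.2) (s z.2) (t z.2))
      (fun i => by
        have := (h z.2).u_pos
        have := (h z.2).v_pos
        fin_cases i <;> simp [leadCoeffs] <;> positivity)
      (h z.2).isCoprime (fun i => (h z.2).abs_coeffs_le hB i) hprod.multipliable
    rw [show singSeries 3 (leadCoeffs (u z.2) (v z.2)) (constCoeffs (u z.2) (s z.2) (t z.2)) = SA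
      from hprod.tprod_eq] at key
    have hfac : 0 < Real.log (y z) ^ 3 / y z := by positivity
    rw [Real.dist_eq]
    calc |N z * Real.log (y z) ^ 3 / y z - SA|
        = |N z - SA * y z / Real.log (y z) ^ 3| * (Real.log (y z) ^ 3 / y z) := by
          rw [← abs_of_pos hfac, ← abs_mul]
          congr 1
          field_simp
      _ ≤ ε * (SA + 1) * y z / Real.log (y z) ^ 3 * (Real.log (y z) ^ 3 / y z) :=
          mul_le_mul_of_nonneg_right key hfac.le
      _ = ε * (SA + 1) := by field_simp
      _ ≤ ε * (|SA| + 1) := by gcongr; exact le_abs_self _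
      _ = δ / 2 := by rw [hε_def]; field_simp
      _ < δ := by linarith
  have hratio := (tendsto_log_rescale_div_log hm hc0 hc).inv₀ one_ne_zero
  have hfinal := (hmain.mul (tendsto_mul_rescale_div hm hc0 hc)).mul (hratio.pow 3)
  simp only [inv_one, one_pow, mul_one] at hfinal
  refine hfinal.congr' ?_
  filter_upwards [hx.eventually_gt_atTop 0, hy.eventually_gt_atTop 0,
    hlogy.eventually_gt_atTop 0, hL.eventually_gt_atTop 0] with z hxz hyz hlogz hLz
  rw [(h z.2).ncard_constellation z.1]
  change N z * Real.log (y z) ^ 3 / y z * (m z.2 * y z / z.1) *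
    (Real.log (y z) / Real.log z.1)⁻¹ ^ 3 = N z * m z.2 * Real.log z.1 ^ 3 / z.1
  field_simp

end Uniform

section Exceptional

/-- Integers divisible by a power of `2` or of `3` exceeding `Y`, or of the form `2^α 3^β q^μ`
with `q, μ ≥ 2`. -/
def exceptional (Y : ℝ) : Set ℕ :=
  {n | ∃ j : ℕ, Y < 2 ^ j ∧ 2 ^ j ∣ n} ∪ {n | ∃ j : ℕ, Y < 3 ^ j ∧ 3 ^ j ∣ n} ∪
    {n | ∃ α β q μ : ℕ, 2 ≤ q ∧ 2 ≤ μ ∧ n = 2 ^ α * 3 ^ β * q ^ μ}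

lemma ncard_pow_dvd_le {Y : ℝ} (hY : 0 < Y) {b : ℕ} (hb : 1 < b) (X : ℕ) :
    (({n : ℕ | ∃ j : ℕ, Y < (b : ℝ) ^ j ∧ b ^ j ∣ n} ∩ Set.Ioc 0 X).ncard : ℝ) ≤ X / Y := by
  classical
  have hex : ∃ j : ℕ, Y < (b : ℝ) ^ j := pow_unbounded_of_one_lt Y (by exact_mod_cast hb)
  have hspec := Nat.find_spec hex
  set j₀ := Nat.find hex
  have hsub : {n : ℕ | ∃ j : ℕ, Y < (b : ℝ) ^ j ∧ b ^ j ∣ n} ∩ Set.Ioc 0 X ⊆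
      ((Finset.Ioc 0 X).filter (b ^ j₀ ∣ ·) : Finset ℕ) := by
    rintro n ⟨⟨j, hj, hdvd⟩, hn⟩
    simp only [Finset.coe_filter, Finset.mem_Ioc, Set.mem_ofPred_eq]
    exact ⟨hn, (pow_dvd_pow b (Nat.find_min' hex hj)).trans hdvd⟩
  have hcard := Set.ncard_le_ncard hsub (Finset.finite_toSet _)
  rw [Set.ncard_coe_finset, Nat.Ioc_filter_dvd_card_eq_div] at hcard
  calc _ ≤ ((X / b ^ j₀ : ℕ) : ℝ) := by exact_mod_cast hcard
    _ ≤ (X : ℝ) / ((b ^ j₀ : ℕ) : ℝ) := Nat.cast_div_le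
    _ ≤ X / Y := by
      push_cast
      exact div_le_div_of_nonneg_left (Nat.cast_nonneg X) hY hspec.le

lemma ncard_powers_le (X : ℕ) :
    ({n | ∃ α β q μ : ℕ, 2 ≤ q ∧ 2 ≤ μ ∧ n = 2 ^ α * 3 ^ β * q ^ μ} ∩ Set.Ioc 0 X).ncard ≤
      (Nat.log 2 X + 1) ^ 3 * (Nat.sqrt X + 1) := by
  set L := Finset.range (Nat.log 2 X + 1) with hL
  set s := L ×ˢ L ×ˢ L ×ˢ Finset.range (Nat.sqrt X + 1) with hs
  have hsub : {n | ∃ α β q μ : ℕ, 2 ≤ q ∧ 2 ≤ μ ∧ n = 2 ^ α * 3 ^ β * q ^ μ} ∩ Set.Ioc 0 X ⊆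
      (fun e : ℕ × ℕ × ℕ × ℕ => 2 ^ e.1 * 3 ^ e.2.1 * e.2.2.2 ^ e.2.2.1) '' (s : Set _) := by
    rintro n ⟨⟨α, β, q, μ, hq, hμ, rfl⟩, hn⟩
    refine ⟨(α, β, μ, q), ?_, rfl⟩
    have hlog : ∀ e : ℕ, 2 ^ e ∣ 2 ^ α * 3 ^ β * q ^ μ ∨ 2 ^ e ≤ 2 ^ α * 3 ^ β * q ^ μ →
        e < Nat.log 2 X + 1 := by
      intro e he
      refine Nat.lt_succ_of_le (Nat.le_log_of_pow_le one_lt_two (le_trans ?_ hn.2))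
      exact he.elim (Nat.le_of_dvd hn.1) id
    have h1 : 0 < 2 ^ α * 3 ^ β := by positivity
    have h2 : 0 < q ^ μ := by positivity
    have h3 : q ^ μ ≤ 2 ^ α * 3 ^ β * q ^ μ := Nat.le_mul_of_pos_left _ h1
    have h4 : 3 ^ β ≤ 2 ^ α * 3 ^ β * q ^ μ :=
      (Nat.le_mul_of_pos_left _ (by positivity)).trans (Nat.le_mul_of_pos_right _ h2)
    simp only [hs, hL, Finset.coe_product, Set.mem_prod, Finset.coe_range, Set.mem_Iio]
    refine ⟨hlog α (.inl ⟨3 ^ β * q ^ μ, by ring⟩), hlog β (.inr (le_trans ?_ h4)),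
      hlog μ (.inr (le_trans (Nat.pow_le_pow_left hq μ) h3)), ?_⟩
    · exact Nat.pow_le_pow_left (by norm_num) β
    · rw [Nat.lt_succ_iff, Nat.le_sqrt, ← sq]
      exact (Nat.pow_le_pow_right (by omega) hμ).trans (h3.trans hn.2)
  calc _ ≤ _ := Set.ncard_le_ncard hsub ((Finset.finite_toSet s).image _)
    _ ≤ (s : Set (ℕ × ℕ × ℕ × ℕ)).ncard := Set.ncard_image_le (Finset.finite_toSet s)
    _ = _ := by
      rw [Set.ncard_coe_finset]
      simp only [hs, hL, Finset.card_product, Finset.card_range]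
      ring

lemma ncard_exceptional_le {Y : ℝ} (hY : 0 < Y) (X : ℕ) :
    ((exceptional Y ∩ Set.Ioc 0 X).ncard : ℝ) ≤
      2 * (X / Y) + (Nat.log 2 X + 1) ^ 3 * (Nat.sqrt X + 1) := by
  have h1 := ncard_pow_dvd_le hY one_lt_two X
  have h2 := ncard_pow_dvd_le hY (show 1 < 3 by norm_num) X
  have h3 : ((({n | ∃ α β q μ : ℕ, 2 ≤ q ∧ 2 ≤ μ ∧ n = 2 ^ α * 3 ^ β * q ^ μ} ∩
      Set.Ioc 0 X).ncard : ℕ) : ℝ) ≤ (Nat.log 2 X + 1) ^ 3 * (Nat.sqrt X + 1) := by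
    exact_mod_cast ncard_powers_le X
  rw [exceptional, Set.union_inter_distrib_right, Set.union_inter_distrib_right]
  push_cast at h1 h2
  have h4 := Set.ncard_union_le ({n | ∃ j : ℕ, Y < 2 ^ j ∧ 2 ^ j ∣ n} ∩ Set.Ioc 0 X ∪
    {n | ∃ j : ℕ, Y < 3 ^ j ∧ 3 ^ j ∣ n} ∩ Set.Ioc 0 X)
    ({n | ∃ α β q μ : ℕ, 2 ≤ q ∧ 2 ≤ μ ∧ n = 2 ^ α * 3 ^ β * q ^ μ} ∩ Set.Ioc 0 X)
  have h5 := Set.ncard_union_le ({n | ∃ j : ℕ, Y < 2 ^ j ∧ 2 ^ j ∣ n} ∩ Set.Ioc 0 X)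
    ({n | ∃ j : ℕ, Y < 3 ^ j ∧ 3 ^ j ∣ n} ∩ Set.Ioc 0 X)
  have h6 := (Nat.cast_le (α := ℝ)).2 (h4.trans (Nat.add_le_add_right h5 _))
  push_cast at h6
  linarith

/-- The integers `2 ≤ p ≤ x` with an element of `exceptional Y` among `p ± 1`. -/
def nearExceptional (Y x : ℝ) : Set ℕ :=
  {p | 2 ≤ p ∧ (p : ℝ) ≤ x ∧ (p + 1 ∈ exceptional Y ∨ p - 1 ∈ exceptional Y)}

lemma ncard_nearExceptional_le {Y : ℝ} (hY : 0 < Y) (x : ℝ) :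
    ((nearExceptional Y x).ncard : ℝ) ≤ 2 * (2 * ((⌊x⌋₊ + 1 : ℕ) / Y) +
      (Nat.log 2 (⌊x⌋₊ + 1) + 1) ^ 3 * (Nat.sqrt (⌊x⌋₊ + 1) + 1)) := by
  set S := exceptional Y ∩ Set.Ioc 0 (⌊x⌋₊ + 1) with hS
  have hfin : S.Finite := (Set.finite_Ioc _ _).inter_of_right _
  have hsub : nearExceptional Y x ⊆ (fun n => n - 1) '' S ∪ (fun n => n + 1) '' S := by
    rintro p ⟨h2, hp, h | h⟩
    · exact .inl ⟨p + 1, ⟨h, by simp, by simpa using Nat.le_floor hp⟩, rfl⟩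
    · have := Nat.le_floor hp
      exact .inr ⟨p - 1, ⟨h, by omega, by omega⟩, by dsimp only; omega⟩
  have h1 := Set.ncard_le_ncard hsub ((hfin.image _).union (hfin.image _))
  have h2 := Set.ncard_union_le ((fun n => n - 1) '' S) ((fun n => n + 1) '' S)
  have h3 := Set.ncard_image_le (f := fun n => n - 1) hfin
  have h4 := Set.ncard_image_le (f := fun n => n + 1) hfin
  have h5 : ((nearExceptional Y x).ncard : ℝ) ≤ 2 * (S.ncard : ℝ) := by
    exact_mod_cast (show (nearExceptional Y x).ncard ≤ 2 * S.ncard by omega)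
  have h6 := ncard_exceptional_le hY (⌊x⌋₊ + 1)
  linarith

lemma tendsto_ncard_nearExceptional :
    Tendsto (fun x : ℝ => ((nearExceptional (Real.log x ^ 4) x).ncard : ℝ) *
      Real.log x ^ 3 / x) atTop (𝓝 0) := by
  have hlim : Tendsto (fun x : ℝ => 8 * (Real.log x)⁻¹ +
      384 * (Real.log x ^ 6 / x ^ (1 / 2 : ℝ))) atTop (𝓝 0) := by
    simpa using (Real.tendsto_log_atTop.inv_tendsto_atTop.const_mul 8).add
      ((tendsto_log_pow_div_rpow_atTop 6 (s := 1 / 2) (by norm_num)).const_mul 384)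
  refine squeeze_zero' ?_ ?_ hlim
  · filter_upwards [eventually_ge_atTop 1] with x hx
    have := Real.log_nonneg hx
    positivity
  · filter_upwards [eventually_ge_atTop 1, Real.tendsto_log_atTop.eventually_ge_atTop 1]
      with x hx hL
    have hx0 : 0 < x := by linarith
    have hL0 : 0 < Real.log x := by linarith
    rw [← Real.sqrt_eq_rpow]
    have hs1 : 1 ≤ √x := Real.one_le_sqrt.2 hx
    have hsq : √x * √x = x := Real.mul_self_sqrt hx0.le
    set X : ℕ := ⌊x⌋₊ + 1 with hX
    have hX2 : (X : ℝ) ≤ 2 * x := by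
      have := Nat.floor_le hx0.le
      push_cast [hX]
      linarith
    have hlogX : (Nat.log 2 X : ℝ) + 1 ≤ 4 * Real.log x := by
      have h1 : (Nat.log 2 X : ℝ) ≤ Real.logb 2 X := by exact_mod_cast Real.natLog_le_logb X 2
      have h2 : Real.logb 2 X ≤ Real.logb 2 (2 * x) :=
        Real.logb_le_logb_of_le one_lt_two (by positivity) hX2
      have h3 : Real.logb 2 (2 * x) = 1 + Real.log x / Real.log 2 := by
        rw [Real.logb_mul two_ne_zero hx0.ne', Real.logb_self_eq_one one_lt_two, Real.logb]
      have h4 : Real.log x / Real.log 2 ≤ 2 * Real.log x := by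
        rw [div_le_iff₀ (Real.log_pos one_lt_two)]
        nlinarith [Real.log_two_gt_d9]
      linarith
    have hsqrtX : (Nat.sqrt X : ℝ) + 1 ≤ 3 * √x := by
      have h1 : (Nat.sqrt X : ℝ) ≤ √X := Real.nat_sqrt_le_real_sqrt
      have h2 : √(X : ℝ) ≤ 2 * √x := by
        rw [Real.sqrt_le_left (by positivity), mul_pow, Real.sq_sqrt hx0.le]
        linarith
      linarith
    have hcard := ncard_nearExceptional_le (pow_pos hL0 4) x
    rw [← hX] at hcard
    have hbound : ((nearExceptional (Real.log x ^ 4) x).ncard : ℝ) ≤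
        2 * (2 * (2 * x / Real.log x ^ 4) + (4 * Real.log x) ^ 3 * (3 * √x)) := by
      refine hcard.trans ?_
      gcongr
    calc _ ≤ 2 * (2 * (2 * x / Real.log x ^ 4) + (4 * Real.log x) ^ 3 * (3 * √x)) *
          Real.log x ^ 3 / x := by gcongr
      _ = 8 * (Real.log x)⁻¹ + 384 * (Real.log x ^ 6 * √x / x) := by field_simp; ring
      _ = _ := by
        congr 2
        rw [div_eq_div_iff (by positivity) (by positivity), mul_assoc, hsq]

end Exceptional

section Decomposition

/-- The primes in `constellation u v` for which the primes `q` and `r` are coprime to `6`. -/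
def strictConstellation (u v : ℕ) : Set ℕ :=
  {p | p.Prime ∧ ∃ q r : ℕ, q.Prime ∧ r.Prime ∧ q.Coprime 6 ∧ r.Coprime 6 ∧
    p + 1 = 2 * v * q ∧ p = 2 * u * r + 1}

lemma strictConstellation_subset (u v : ℕ) : strictConstellation u v ⊆ constellation u v :=
  fun _ ⟨hp, q, r, hq, hr, _, _, h⟩ => ⟨hp, q, r, hq, hr, h⟩

lemma Nat.Prime.coprime_six {q : ℕ} (hq : q.Prime) (h2 : q ≠ 2) (h3 : q ≠ 3) : q.Coprime 6 :=
  Nat.Coprime.mul_right (m := 2) (n := 3) ((Nat.coprime_primes hq Nat.prime_two).2 h2)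
    ((Nat.coprime_primes hq Nat.prime_three).2 h3)

lemma finite_inter_le (S : Set ℕ) (x : ℝ) : (S ∩ {n : ℕ | (n : ℝ) ≤ x}).Finite :=
  (Set.finite_Iic ⌊x⌋₊).subset fun _ hn => Nat.le_floor hn.2

lemma ncard_constellation_le (u v : ℕ) (x : ℝ) :
    (constellation u v ∩ {n : ℕ | (n : ℝ) ≤ x}).ncard ≤
      (strictConstellation u v ∩ {n : ℕ | (n : ℝ) ≤ x}).ncard + 4 := by
  set F : Finset ℕ := {2 * v * 2 - 1, 2 * v * 3 - 1, 2 * u * 2 + 1, 2 * u * 3 + 1} with hF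
  have hsub : constellation u v ∩ {n : ℕ | (n : ℝ) ≤ x} ⊆
      (strictConstellation u v ∩ {n : ℕ | (n : ℝ) ≤ x}) ∪ (F : Set ℕ) := by
    rintro p ⟨⟨hp, q, r, hq, hr, h1, h2⟩, hx⟩
    simp only [hF, Set.mem_union, Finset.coe_insert, Finset.coe_singleton, Set.mem_insert_iff,
      Set.mem_singleton_iff]
    by_cases hq2 : q = 2
    · subst hq2; omega
    by_cases hq3 : q = 3
    · subst hq3; omega
    by_cases hr2 : r = 2
    · subst hr2; omega
    by_cases hr3 : r = 3
    · subst hr3; omega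
    exact .inl ⟨⟨hp, q, r, hq, hr, hq.coprime_six hq2 hq3, hr.coprime_six hr2 hr3, h1, h2⟩, hx⟩
  refine (Set.ncard_le_ncard hsub ((finite_inter_le _ x).union F.finite_toSet)).trans ?_
  refine (Set.ncard_union_le _ _).trans (Nat.add_le_add_left ?_ _)
  rw [Set.ncard_coe_finset]
  exact Finset.card_le_four

/-- The parameter `u` attached to an index: `2 ^ (i + 1)` or `1`. -/
def uParam (k : ℕ × ℕ × Bool) : ℕ := if k.2.2 then 2 ^ (k.1 + 1) else 1

/-- The parameter `v` attached to an index: `3 ^ (b + 1)` or `2 ^ (i + 1) * 3 ^ (b + 1)`. -/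
def vParam (k : ℕ × ℕ × Bool) : ℕ :=
  if k.2.2 then 3 ^ (k.2.1 + 1) else 2 ^ (k.1 + 1) * 3 ^ (k.2.1 + 1)

lemma uParam_mul_vParam (k : ℕ × ℕ × Bool) :
    uParam k * vParam k = 2 ^ (k.1 + 1) * 3 ^ (k.2.1 + 1) := by
  obtain ⟨i, b, τ⟩ := k
  cases τ <;> simp [uParam, vParam]

lemma exists_isAdmissible (k : ℕ × ℕ × Bool) :
    ∃ s t, IsAdmissible (uParam k) (vParam k) s t := by
  have h2 : 2 ∣ uParam k * vParam k := by
    rw [uParam_mul_vParam]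
    exact (dvd_pow_self 2 (by omega)).mul_right _
  have h5 : ∀ ℓ : ℕ, ℓ.Prime → 5 ≤ ℓ → ¬ ℓ ∣ uParam k * vParam k := by
    intro ℓ hℓ hge hdvd
    rw [uParam_mul_vParam] at hdvd
    rcases (hℓ.dvd_mul).1 hdvd with h | h
    · have := Nat.le_of_dvd (by norm_num) (hℓ.dvd_of_dvd_pow h); omega
    · have := Nat.le_of_dvd (by norm_num) (hℓ.dvd_of_dvd_pow h); omega
  have h3 : 3 ∣ vParam k := by
    obtain ⟨i, b, τ⟩ := k
    have : 3 ∣ 3 ^ (b + 1) := dvd_pow_self 3 (by omega)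
    cases τ
    · exact this.mul_left _
    · exact this
  have hv : 0 < vParam k := by
    obtain ⟨i, b, τ⟩ := k
    cases τ <;> simp [vParam]
  obtain ⟨i, b, τ⟩ := k
  cases τ
  · refine ⟨1, vParam (i, b, false) - 1, by simp [uParam], hv, ?_, h2, h3, h5,
      by simp [uParam]⟩
    simp only [uParam, Bool.false_eq_true, if_false]
    omega
  · have hu : 1 < uParam (i, b, true) := Nat.one_lt_two_pow (by omega)
    have hcop : (vParam (i, b, true)).Coprime (uParam (i, b, true)) :=
      Nat.Coprime.pow _ _ (by norm_num)
    obtain ⟨s, hs, hmod⟩ := Nat.exists_mul_mod_eq_one_of_coprime hcop hu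
    refine ⟨s, vParam (i, b, true) * s / uParam (i, b, true), by omega, hv, ?_, h2, h3, h5,
      hs.le⟩
    rw [← hmod]
    exact (Nat.div_add_mod _ _).symm

lemma strictConstellation_subset_Abar (k : ℕ × ℕ × Bool) :
    strictConstellation (uParam k) (vParam k) ⊆ Abar := by
  rintro p ⟨hp, q, r, hq, hr, hq6, hr6, h1, h2⟩
  have hmod : p % 3 = 2 := by
    obtain ⟨s, t, h⟩ := exists_isAdmissible k
    obtain ⟨w, hw⟩ := h.three_dvd
    rw [hw, show 2 * (3 * w) * q = 3 * (2 * w * q) by ring] at h1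
    omega
  obtain ⟨i, b, τ⟩ := k
  refine ⟨hp, hmod, ?_⟩
  cases τ
  · refine ⟨i + 2, b + 1, 1, 1, 1, q, r, by omega, by omega, le_rfl, le_rfl, le_rfl, hq, hr,
      hq6, hr6, ?_, ?_⟩
    · rw [h1]; simp only [vParam, Bool.false_eq_true, if_false]; ring
    · rw [h2]; simp [uParam]
  · refine ⟨1, b + 1, i + 2, 1, 1, q, r, le_rfl, by omega, by omega, le_rfl, le_rfl, hq, hr,
      hq6, hr6, ?_, ?_⟩
    · rw [h1]; simp only [vParam, if_true]; ring
    · rw [h2]; simp only [uParam, if_true, Nat.add_sub_cancel]; ring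

lemma Nat.pow_mul_left_inj_of_not_dvd {l a b M M' : ℕ} (hl : 1 < l) (hM : ¬ l ∣ M)
    (hM' : ¬ l ∣ M') (h : l ^ a * M = l ^ b * M') : a = b := by
  have key : ∀ {a b M M' : ℕ}, ¬ l ∣ M → l ^ a * M = l ^ b * M' → ¬ a < b := by
    intro a b M M' hM h hab
    obtain ⟨d, rfl⟩ := Nat.exists_eq_add_of_lt hab
    refine hM ⟨l ^ d * M', Nat.eq_of_mul_eq_mul_left (pow_pos (by omega) a : 0 < l ^ a) ?_⟩
    rw [h]; ring
  exact le_antisymm (not_lt.1 (key hM' h.symm)) (not_lt.1 (key hM h))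

lemma Nat.two_three_exponents_inj {a a' b b' q q' : ℕ} (hq : q.Coprime 6) (hq' : q'.Coprime 6)
    (h : 2 ^ a * 3 ^ b * q = 2 ^ a' * 3 ^ b' * q') : a = a' ∧ b = b' := by
  have hn : ∀ {q : ℕ}, q.Coprime 6 → ∀ l ∈ [2, 3], ¬ l ∣ q := by
    intro q hq l hl hdvd
    have hl6 : l ∣ 6 := by fin_cases hl <;> norm_num
    have := Nat.eq_one_of_dvd_coprimes hq hdvd hl6
    simp [this] at hl
  have h2 : ∀ {b q : ℕ}, q.Coprime 6 → ¬ 2 ∣ 3 ^ b * q := fun {b q} hq hd =>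
    ((Nat.prime_two.dvd_mul).1 hd).elim
      (fun h => absurd (Nat.prime_two.dvd_of_dvd_pow h) (by norm_num)) (hn hq 2 (by simp))
  have h3 : ∀ {a q : ℕ}, q.Coprime 6 → ¬ 3 ∣ 2 ^ a * q := fun {a q} hq hd =>
    ((Nat.prime_three.dvd_mul).1 hd).elim
      (fun h => absurd (Nat.prime_three.dvd_of_dvd_pow h) (by norm_num)) (hn hq 3 (by simp))
  exact ⟨Nat.pow_mul_left_inj_of_not_dvd one_lt_two (h2 hq) (h2 hq')
      (by rw [← mul_assoc, ← mul_assoc]; exact h),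
    Nat.pow_mul_left_inj_of_not_dvd (l := 3) (by norm_num) (h3 (a := a) hq) (h3 (a := a') hq')
      (by linarith)⟩

lemma pairwise_disjoint_strictConstellation {k k' : ℕ × ℕ × Bool} {p : ℕ}
    (h : p ∈ strictConstellation (uParam k) (vParam k))
    (h' : p ∈ strictConstellation (uParam k') (vParam k')) : k = k' := by
  obtain ⟨-, q, r, -, -, hq, hr, h1, h2⟩ := h
  obtain ⟨-, q', r', -, -, hq', hr', h1', h2'⟩ := h'
  have hplus : 2 * vParam k * q = 2 * vParam k' * q' := h1.symm.trans h1'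
  have hminus : 2 * uParam k * r = 2 * uParam k' * r' := by omega
  have hu : ∀ k : ℕ × ℕ × Bool, 2 * uParam k = 2 ^ (if k.2.2 then k.1 + 2 else 1) * 3 ^ 0 := by
    rintro ⟨i, b, τ⟩
    cases τ <;> simp [uParam]; ring
  have hv : ∀ k : ℕ × ℕ × Bool,
      2 * vParam k = 2 ^ (if k.2.2 then 1 else k.1 + 2) * 3 ^ (k.2.1 + 1) := by
    rintro ⟨i, b, τ⟩
    cases τ <;> simp [vParam]; ring
  rw [hu, hu] at hminus
  rw [hv, hv] at hplus
  have e1 := (Nat.two_three_exponents_inj hr hr' hminus).1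
  have e2 := Nat.two_three_exponents_inj hq hq' hplus
  obtain ⟨i, b, τ⟩ := k
  obtain ⟨i', b', τ'⟩ := k'
  cases τ <;> cases τ' <;> simp at e1 e2 ⊢ <;> omega

/-- The indices whose prime powers are at most `Y`. -/
def smallIndices (Y : ℝ) : Set (ℕ × ℕ × Bool) :=
  {k | (2 : ℝ) ^ (k.1 + 1) ≤ Y ∧ (3 : ℝ) ^ (k.2.1 + 1) ≤ Y}

lemma finite_smallIndices (Y : ℝ) : (smallIndices Y).Finite := by
  have hbound : ∀ {b : ℕ}, 2 ≤ b → ∀ {i : ℕ}, (b : ℝ) ^ (i + 1) ≤ Y → i ≤ ⌊Y⌋₊ := by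
    intro b hb i hi
    have h1 : b ^ (i + 1) ≤ ⌊Y⌋₊ := Nat.le_floor (by exact_mod_cast hi)
    have h2 : i + 1 < b ^ (i + 1) := Nat.lt_pow_self (by omega)
    omega
  refine ((Set.finite_Iic ⌊Y⌋₊).prod ((Set.finite_Iic ⌊Y⌋₊).prod Set.finite_univ)).subset ?_
  rintro ⟨i, b, τ⟩ ⟨h1, h2⟩
  exact ⟨hbound (b := 2) le_rfl (by exact_mod_cast h1),
    hbound (b := 3) (by norm_num) (by exact_mod_cast h2), trivial⟩

lemma exists_mem_strictConstellation_or {Y x : ℝ} {p : ℕ} (hp : p ∈ Abar) (hx : (p : ℝ) ≤ x) :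
    (∃ k ∈ smallIndices Y, p ∈ strictConstellation (uParam k) (vParam k)) ∨
      p ∈ nearExceptional Y x := by
  obtain ⟨hpp, -, α, β, γ, μ, ν, q, r, hα, hβ, hγ, hμ, hν, hq, hr, hq6, hr6, h1, h2⟩ := hp
  refine or_iff_not_imp_right.2 fun hnear => ?_
  have hp2 := hpp.two_le
  have hne : p + 1 ∉ exceptional Y ∧ p - 1 ∉ exceptional Y := by
    rw [← not_or]
    exact fun h => hnear ⟨hp2, hx, h⟩
  simp only [exceptional, Set.mem_union, Set.mem_ofPred_eq, not_or, not_exists, not_and] at hne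
  obtain ⟨⟨⟨hp2', hp3⟩, hppow⟩, ⟨hm2, hm3⟩, hmpow⟩ := hne
  have hμ1 : μ = 1 := by
    by_contra hμ1
    exact hppow α β q μ hq.two_le (by omega) h1
  have hν1 : ν = 1 := by
    by_contra hν1
    exact hmpow γ 0 r ν hr.two_le (by omega) (by rw [h2]; ring)
  subst hμ1 hν1
  rw [pow_one] at h1 h2
  have hthree : (3 : ℝ) ^ β ≤ Y := not_lt.1 fun h => hp3 β h ⟨2 ^ α * q, by rw [h1]; ring⟩
  have hodd : ∀ {q : ℕ}, q.Coprime 6 → q % 2 = 1 := fun {q} hq =>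
    Nat.odd_iff.1 (Nat.coprime_two_right.1 (hq.coprime_dvd_right (by norm_num)))
  obtain ⟨β, rfl⟩ := Nat.exists_eq_add_of_le' hβ
  rcases Nat.lt_or_ge 1 γ with hγ2 | hγ1
  · obtain ⟨i, rfl⟩ := Nat.exists_eq_add_of_le' hγ2
    have hα1 : α = 1 := by
      by_contra hα1
      obtain ⟨j, rfl⟩ := Nat.exists_eq_add_of_le' (show 2 ≤ α by omega)
      have e1 : p + 1 = 4 * (2 ^ j * 3 ^ (β + 1) * q) := by rw [h1]; ring
      have e2 : p - 1 = 4 * (2 ^ i * r) := by rw [h2]; ring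
      omega
    subst hα1
    have htwo : (2 : ℝ) ^ (i + 1) ≤ Y :=
      not_lt.1 fun h => hm2 (i + 1) h ⟨2 * r, by rw [h2]; ring⟩
    refine ⟨(i, β, true), ⟨htwo, hthree⟩, hpp, q, r, hq, hr, hq6, hr6, ?_, ?_⟩
    · rw [h1]; simp [vParam]
    · have : p - 1 = 2 * uParam (i, β, true) * r := by rw [h2]; simp only [uParam, if_true]; ring
      omega
  · obtain rfl : γ = 1 := by omega
    have hα2 : 2 ≤ α := by
      by_contra hα2
      obtain rfl : α = 1 := by omega
      have hodd1 : (3 ^ (β + 1) * q) % 2 = 1 := by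
        rw [Nat.mul_mod, Nat.pow_mod, hodd hq6]; norm_num
      have e1 : p + 1 = 2 * (3 ^ (β + 1) * q) := by rw [h1]; ring
      have := hodd hr6
      omega
    obtain ⟨i, rfl⟩ := Nat.exists_eq_add_of_le' hα2
    have htwo : (2 : ℝ) ^ (i + 1) ≤ Y :=
      not_lt.1 fun h => hp2' (i + 1) h ⟨2 * 3 ^ (β + 1) * q, by rw [h1]; ring⟩
    refine ⟨(i, β, false), ⟨htwo, hthree⟩, hpp, q, r, hq, hr, hq6, hr6, ?_, ?_⟩
    · rw [h1]; simp only [vParam, Bool.false_eq_true, if_false]; ring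
    · simp only [uParam, Bool.false_eq_true, if_false]; omega

lemma finite_nearExceptional (Y x : ℝ) : (nearExceptional Y x).Finite :=
  (Set.finite_Iic ⌊x⌋₊).subset fun _ hn => Nat.le_floor hn.2.1

/-- Up to elements near the exceptional set, `Abar` is counted by the strict constellations with
small indices. -/
lemma ncard_Abar_bounds (Y x : ℝ) :
    ∑ k ∈ (finite_smallIndices Y).toFinset,
        (strictConstellation (uParam k) (vParam k) ∩ {n : ℕ | (n : ℝ) ≤ x}).ncard ≤
      (Abar ∩ {n : ℕ | (n : ℝ) ≤ x}).ncard ∧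
    (Abar ∩ {n : ℕ | (n : ℝ) ≤ x}).ncard ≤
      ∑ k ∈ (finite_smallIndices Y).toFinset,
        (strictConstellation (uParam k) (vParam k) ∩ {n : ℕ | (n : ℝ) ≤ x}).ncard +
      (nearExceptional Y x).ncard := by
  have hunion := (finite_smallIndices Y).ncard_biUnion
    (s := fun k => strictConstellation (uParam k) (vParam k) ∩ {n : ℕ | (n : ℝ) ≤ x})
    (fun k _ => finite_inter_le _ x) (fun k _ k' _ hkk' => Set.disjoint_left.2
      fun p hp hp' => hkk' (pairwise_disjoint_strictConstellation hp.1 hp'.1))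
  rw [finsum_mem_eq_finite_toFinset_sum _ (finite_smallIndices Y)] at hunion
  rw [← hunion]
  constructor
  · refine Set.ncard_le_ncard (Set.iUnion₂_subset fun k _ => ?_) (finite_inter_le _ x)
    exact Set.inter_subset_inter_left _ (strictConstellation_subset_Abar k)
  · refine le_trans (Set.ncard_le_ncard ?_ (((finite_smallIndices Y).biUnion fun k _ =>
      finite_inter_le _ x).union (finite_nearExceptional Y x))) (Set.ncard_union_le _ _)
    rintro p ⟨hp, hx⟩
    rcases exists_mem_strictConstellation_or (Y := Y) hp hx with ⟨k, hk, hpk⟩ | h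
    · exact .inl (Set.mem_iUnion₂.2 ⟨k, hk, hpk, hx⟩)
    · exact .inr h

end Decomposition

lemma hasSum_inv_modulus :
    HasSum (fun k : ℕ × ℕ × Bool => ((2 * uParam k * vParam k : ℝ))⁻¹) (1 / 2) := by
  have hgeom : ∀ {r : ℝ}, 0 ≤ r → r < 1 → HasSum (fun n : ℕ => r ^ (n + 1)) (r * (1 - r)⁻¹) := by
    intro r h0 h1
    simpa [pow_succ'] using (hasSum_geometric_of_lt_one h0 h1).mul_left r
  have h2 := hgeom (r := 1 / 2) (by norm_num) (by norm_num)
  have h3 := hgeom (r := 1 / 3) (by norm_num) (by norm_num)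
  have hb : HasSum (fun _ : Bool => (1 / 2 : ℝ)) 1 := by
    convert hasSum_fintype (fun _ : Bool => (1 / 2 : ℝ)) using 1
    norm_num
  have h3b := h3.mul hb (h3.summable.mul_of_nonneg hb.summable (fun _ => by positivity)
    (fun _ => by norm_num))
  have h := h2.mul h3b (h2.summable.mul_of_nonneg h3b.summable (fun _ => by positivity)
    (fun _ => by positivity))
  have hval : (1 / 2 * (1 - 1 / 2)⁻¹ * (1 / 3 * (1 - 1 / 3)⁻¹ * 1) : ℝ) = 1 / 2 := by norm_num
  rw [hval] at h
  refine Eq.subst (motive := fun f => HasSum f (1 / 2 : ℝ)) (funext fun k => ?_) h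
  symm
  have hk : (uParam k * vParam k : ℝ) = 2 ^ (k.1 + 1) * 3 ^ (k.2.1 + 1) := by
    exact_mod_cast uParam_mul_vParam k
  rw [mul_assoc, hk]
  simp only [one_div, inv_pow, mul_inv]
  ring

lemma tendsto_log_pow_three_mul_const_div (c : ℝ) :
    Tendsto (fun x : ℝ => c * Real.log x ^ 3 / x) atTop (𝓝 0) := by
  simpa [mul_div_assoc] using (tendsto_log_pow_div_atTop 3).const_mul c

/-- The main term: the strict constellations with small indices have total density `SA / 2`. -/
lemma tendsto_sum_strictConstellation (hGHL : GHL) :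
    Tendsto (fun x : ℝ => (∑ k ∈ (finite_smallIndices (Real.log x ^ 4)).toFinset,
        ((strictConstellation (uParam k) (vParam k) ∩ {n : ℕ | (n : ℝ) ≤ x}).ncard : ℝ)) *
          Real.log x ^ 3 / x) atTop (𝓝 (SA / 2)) := by
  classical
  choose s t hst using exists_isAdmissible
  have huniform := tendsto_ncard_constellation hGHL hst
  set m : ℕ × ℕ × Bool → ℝ := fun k => 2 * uParam k * vParam k with hm
  have hmpos : ∀ k, 0 < m k := fun k => by
    have := (hst k).u_pos
    have := (hst k).v_pos
    positivity
  set N : ℝ → ℕ × ℕ × Bool → ℝ := fun x k =>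
    (constellation (uParam k) (vParam k) ∩ {n : ℕ | (n : ℝ) ≤ x}).ncard with hN
  set N' : ℝ → ℕ × ℕ × Bool → ℝ := fun x k =>
    (strictConstellation (uParam k) (vParam k) ∩ {n : ℕ | (n : ℝ) ≤ x}).ncard with hN'
  have hle : ∀ x k, N' x k ≤ N x k := fun x k =>
    Nat.cast_le.2 <| Set.ncard_le_ncard
      (Set.inter_subset_inter_left _ (strictConstellation_subset _ _)) (finite_inter_le _ x)
  have hge : ∀ x k, N x k ≤ N' x k + 4 := fun x k => by
    simp only [hN, hN']
    exact_mod_cast ncard_constellation_le (uParam k) (vParam k) x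
  have hlog : Tendsto (fun x : ℝ => Real.log x ^ 4) atTop atTop :=
    (tendsto_pow_atTop (by norm_num)).comp Real.tendsto_log_atTop
  have hlim : ∀ k, Tendsto (fun x => if k ∈ smallIndices (Real.log x ^ 4) then
      N' x k * Real.log x ^ 3 / x else 0) atTop (𝓝 (SA * (m k)⁻¹)) := by
    intro k
    have h1 : Tendsto (fun x => N x k * Real.log x ^ 3 / x) atTop (𝓝 (SA * (m k)⁻¹)) := by
      refine ((huniform.comp (tendsto_prodMk_polylogFilter m k)).mul_const (m k)⁻¹).congr
        fun x => ?_
      change N x k * m k * Real.log x ^ 3 / x * (m k)⁻¹ = _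
      have := (hmpos k).ne'
      field_simp
    have h2 : Tendsto (fun x => N' x k * Real.log x ^ 3 / x) atTop (𝓝 (SA * (m k)⁻¹)) := by
      have h3 := h1.sub (tendsto_log_pow_three_mul_const_div 4)
      rw [sub_zero] at h3
      refine tendsto_of_tendsto_of_tendsto_of_le_of_le' h3 h1 ?_ ?_
      · filter_upwards [eventually_ge_atTop 1] with x hx
        have hL := Real.log_nonneg hx
        rw [← sub_div, ← sub_mul]
        gcongr
        linarith [hge x k]
      · filter_upwards [eventually_ge_atTop 1] with x hx
        have hL := Real.log_nonneg hx
        gcongr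
        exact hle x k
    refine h2.congr' ?_
    filter_upwards [hlog.eventually_ge_atTop (2 ^ (k.1 + 1)),
      hlog.eventually_ge_atTop (3 ^ (k.2.1 + 1))] with x hx2 hx3
    exact (if_pos ⟨hx2, hx3⟩).symm
  have hbound : ∀ᶠ x : ℝ in atTop, ∀ k, ‖if k ∈ smallIndices (Real.log x ^ 4) then
      N' x k * Real.log x ^ 3 / x else 0‖ ≤ (|SA| + 1) * (m k)⁻¹ := by
    have hev : ∀ᶠ z in polylogFilter m, N z.1 z.2 * m z.2 * Real.log z.1 ^ 3 / z.1 < |SA| + 1 :=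
      huniform.eventually (gt_mem_nhds ((le_abs_self SA).trans_lt (lt_add_one _)))
    rw [polylogFilter, eventually_inf_principal, eventually_comap] at hev
    filter_upwards [hev, eventually_ge_atTop 1, Real.tendsto_log_atTop.eventually_ge_atTop 2]
      with x hx hx1 hL k
    have hm0 := hmpos k
    split_ifs with hk
    · have hmk : m k ≤ Real.log x ^ 9 := by
        have huv : m k = 2 * (2 ^ (k.1 + 1) * 3 ^ (k.2.1 + 1)) := by
          have := uParam_mul_vParam k
          simp only [hm, mul_assoc]
          exact_mod_cast congrArg (fun n : ℕ => 2 * n) this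
        calc m k = 2 * (2 ^ (k.1 + 1) * 3 ^ (k.2.1 + 1)) := huv
          _ ≤ Real.log x * (Real.log x ^ 4 * Real.log x ^ 4) := by
            gcongr
            exacts [hk.1, hk.2]
          _ = Real.log x ^ 9 := by ring
      have h := (hx (x, k) rfl hmk).le
      have hN0 : 0 ≤ N' x k := Nat.cast_nonneg _
      rw [Real.norm_of_nonneg (by positivity), ← div_eq_mul_inv, le_div_iff₀ hm0]
      calc N' x k * Real.log x ^ 3 / x * m k ≤ N x k * Real.log x ^ 3 / x * m k := by
            gcongr
            exact hle x k
        _ = N x k * m k * Real.log x ^ 3 / x := by ring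
        _ ≤ |SA| + 1 := h
    · rw [norm_zero]
      positivity
  have hmain := tendsto_tsum_of_dominated_convergence
    (hasSum_inv_modulus.summable.mul_left (|SA| + 1)) hlim hbound
  rw [(hasSum_inv_modulus.mul_left SA).tsum_eq, mul_one_div] at hmain
  refine hmain.congr fun x => ?_
  rw [tsum_eq_sum (s := (finite_smallIndices (Real.log x ^ 4)).toFinset), Finset.sum_mul,
    Finset.sum_div]
  · exact Finset.sum_congr rfl fun k hk => if_pos ((Set.Finite.mem_toFinset _).1 hk)
  · exact fun k hk => if_neg fun h => hk ((Set.Finite.mem_toFinset _).2 h)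

theorem Abar_density (hGHL : GHL) :
    Filter.Tendsto
      (fun x : ℝ => ((Abar ∩ {n : ℕ | (n : ℝ) ≤ x}).ncard : ℝ) * (Real.log x) ^ 3 / x)
      Filter.atTop (nhds (SA / 2)) := by
  have hmain := tendsto_sum_strictConstellation hGHL
  have hupper := hmain.add tendsto_ncard_nearExceptional
  rw [add_zero] at hupper
  refine tendsto_of_tendsto_of_tendsto_of_le_of_le' hmain hupper ?_ ?_
  · filter_upwards [eventually_ge_atTop 1] with x hx
    have hL := Real.log_nonneg hx
    gcongr
    exact_mod_cast (ncard_Abar_bounds (Real.log x ^ 4) x).1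
  · filter_upwards [eventually_ge_atTop 1] with x hx
    have hL := Real.log_nonneg hx
    rw [← add_div, ← add_mul]
    gcongr
    exact_mod_cast (ncard_Abar_bounds (Real.log x ^ 4) x).2
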